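/- arXiv:1908.11793 — 2 statements merged into one kernel-verified Lean document; each statement's English description precedes it below -/
import Mathlib

section
/- Let p be a prime, q = p^r with r ≥ 1, let L : 𝔽_q → 𝔽_q be an 𝔽_p-linear map, let k > 1 be an integer, D = p^{⌊log_p k⌋+1}, let j ≥ 1 and fix β = (β_1,…,β_j) ∈ 𝔽_q^j. Then for every γ ∈ 𝔽_q, the real sequence (1/q^n) · #{ y ∈ 𝔽_q^n : L(∑_{m=0}^{min(j,k)} e_m(β) · e_{k−m}(y)) = γ } converges as n → ∞, and its limit equals D^{−(q−1)} · #{ b : 𝔽_q^× → {0,1,…,D−1} : L(esymm_k(M_b)) = γ }; in particular, this limit is the same as the limit of (1/q^n) · #{ y ∈ 𝔽_q^n : L(e_k(y)) = γ }. -/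
open Filter Topology

/-- The elementary symmetric polynomial of degree `k` evaluated at `x ∈ K^n`. -/
def evalE {K : Type*} [CommSemiring K] {n : ℕ} (k : ℕ) (x : Fin n → K) : K :=
  (Multiset.map x Finset.univ.val).esymm k

/-- `Mb b` is the multiset containing each nonzero (unit) `α` with multiplicity `b α`. -/
def Mb {K : Type*} [Monoid K] [Fintype K] [DecidableEq K] {D : ℕ}
    (b : Kˣ → Fin D) : Multiset K :=
  ∑ α : Kˣ, Multiset.replicate (b α : ℕ) (α : K)

section Helpers

open Polynomial

theorem aux_map_sum {G ι : Type*} [AddCommGroup G] (χ : AddChar G ℂ) (s : Finset ι) (f : ι → G) :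
    χ (∑ i ∈ s, f i) = ∏ i ∈ s, χ (f i) := by
  classical
  induction s using Finset.induction_on with
  | empty => simp
  | insert a s ha ih =>
    rw [Finset.sum_insert ha, Finset.prod_insert ha, AddChar.map_add_eq_mul, ih]

/-- Fourier-analytic equidistribution of a random walk on a finite abelian group. -/
theorem aux_equidist {G A : Type*} [AddCommGroup G] [Fintype G] [DecidableEq G] [Fintype A]
    [Nonempty A]
    (s : A → G) (hs : ∀ χ : AddChar G ℂ, χ ≠ 0 → ‖∑ a, χ (s a)‖ < Fintype.card A)
    (P : G → Prop) [DecidablePred P] :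
    Tendsto (fun n : ℕ =>
      ((Finset.univ.filter (fun y : Fin n → A => P (∑ i, s (y i)))).card : ℝ) /
        (Fintype.card A : ℝ) ^ n) atTop
      (𝓝 (((Finset.univ.filter P).card : ℝ) / (Fintype.card G : ℝ))) := by
  have hG : (Fintype.card G : ℂ) ≠ 0 := by exact_mod_cast Fintype.card_ne_zero
  have hA : (Fintype.card A : ℂ) ≠ 0 := by exact_mod_cast Fintype.card_ne_zero
  have hA' : (0 : ℝ) < (Fintype.card A : ℝ) := by exact_mod_cast Fintype.card_pos
  have key : ∀ n : ℕ,
      (((Finset.univ.filter (fun y : Fin n → A => P (∑ i, s (y i)))).card : ℂ)) /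
        (Fintype.card A : ℂ) ^ n
      = (∑ g ∈ Finset.univ.filter P, ∑ χ : AddChar G ℂ,
          χ (-g) * ((∑ a, χ (s a)) / (Fintype.card A : ℂ)) ^ n) / (Fintype.card G : ℂ) := by
    intro n
    have h1 : (((Finset.univ.filter (fun y : Fin n → A => P (∑ i, s (y i)))).card : ℂ))
        = ∑ g ∈ Finset.univ.filter P, ∑ y : Fin n → A,
            (if (∑ i, s (y i)) - g = 0 then (1 : ℂ) else 0) := by
      rw [Finset.sum_comm, Finset.card_filter]
      push_cast
      refine Finset.sum_congr rfl fun y _ => ?_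
      simp only [sub_eq_zero]
      rw [Finset.sum_ite_eq]
      simp
    have h2 : ∀ g : G, (∑ y : Fin n → A, (if (∑ i, s (y i)) - g = 0 then (1 : ℂ) else 0))
        = (∑ χ : AddChar G ℂ, χ (-g) * (∑ a, χ (s a)) ^ n) / (Fintype.card G : ℂ) := by
      intro g
      rw [eq_div_iff hG, Finset.sum_mul]
      have : ∀ y : Fin n → A, (if (∑ i, s (y i)) - g = 0 then (1 : ℂ) else 0) *
          (Fintype.card G : ℂ) = ∑ χ : AddChar G ℂ, χ (-g) * ∏ i, χ (s (y i)) := by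
        intro y
        rw [ite_mul, one_mul, zero_mul, ← AddChar.sum_apply_eq_ite]
        refine Finset.sum_congr rfl fun χ _ => ?_
        rw [sub_eq_add_neg, AddChar.map_add_eq_mul, aux_map_sum, mul_comm]
      simp_rw [this]
      rw [Finset.sum_comm]
      refine Finset.sum_congr rfl fun χ _ => ?_
      rw [← Finset.mul_sum, Fintype.sum_pow]
    rw [h1]
    simp_rw [h2, ← Finset.sum_div, div_pow, mul_div_assoc', ← Finset.sum_div]
    rw [div_right_comm]
  have lim : Tendsto (fun n : ℕ => (∑ g ∈ Finset.univ.filter P, ∑ χ : AddChar G ℂ,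
          χ (-g) * ((∑ a, χ (s a)) / (Fintype.card A : ℂ)) ^ n) / (Fintype.card G : ℂ)) atTop
      (𝓝 ((∑ g ∈ Finset.univ.filter P, ∑ χ : AddChar G ℂ,
          χ (-g) * (if χ = 0 then 1 else 0)) / (Fintype.card G : ℂ))) := by
    refine Tendsto.div_const (tendsto_finsetSum _ fun g _ => tendsto_finsetSum _ fun χ _ => ?_) _
    refine Tendsto.const_mul _ ?_
    split_ifs with h
    · subst h
      have h1 : (fun n : ℕ => ((∑ a, (0 : AddChar G ℂ) (s a)) / (Fintype.card A : ℂ)) ^ n)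
          = fun _ => 1 := by
        funext n
        simp
      refine Tendsto.congr (fun n => (congrFun h1 n).symm) tendsto_const_nhds
    · apply tendsto_pow_atTop_nhds_zero_of_norm_lt_one
      rw [norm_div, Complex.norm_natCast, div_lt_one hA']
      exact hs χ h
  simp_rw [← key] at lim
  have e : ((∑ g ∈ Finset.univ.filter P, ∑ χ : AddChar G ℂ,
          χ (-g) * (if χ = 0 then 1 else 0)) / (Fintype.card G : ℂ))
      = ((((Finset.univ.filter P).card : ℝ) / (Fintype.card G : ℝ) : ℝ) : ℂ) := by
    simp
  rw [e] at lim
  have := (Complex.continuous_re.tendsto _).comp lim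
  refine this.congr fun n => ?_
  simp only [Function.comp]
  rw [← Complex.ofReal_re (((Finset.univ.filter (fun y : Fin n → A => P (∑ i, s (y i)))).card : ℝ) /
        (Fintype.card A : ℝ) ^ n)]
  push_cast
  rfl

/-- Generating polynomial. -/
noncomputable def auxP {K : Type*} [CommRing K] (m : Multiset K) : K[X] :=
  (m.map (fun a => 1 + C a * X)).prod

theorem auxP_coeff {K : Type*} [CommRing K] (m : Multiset K) (k : ℕ) :
    (auxP m).coeff k = m.esymm k := by
  induction m using Multiset.induction_on generalizing k with
  | empty =>
    cases k <;> simp [auxP, Multiset.esymm, coeff_one, Multiset.powersetCard_zero_right]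
  | cons a s ih =>
    have : auxP (a ::ₘ s) = auxP s + C a * (auxP s * X) := by
      simp [auxP]; ring
    rw [this, coeff_add, coeff_C_mul]
    cases k with
    | zero => simp [ih, Multiset.esymm]
    | succ k =>
      rw [coeff_mul_X, ih, ih]
      simp [Multiset.esymm, Multiset.powersetCard_cons, Multiset.map_map, Function.comp_def,
        Multiset.sum_map_mul_left]

theorem auxP_add {K : Type*} [CommRing K] (m m' : Multiset K) :
    auxP (m + m') = auxP m * auxP m' := by simp [auxP]

theorem aux_esymm_add {K : Type*} [CommRing K] (m m' : Multiset K) (k : ℕ) :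
    (m + m').esymm k =
      ∑ t ∈ Finset.range (min m.card k + 1), m.esymm t * m'.esymm (k - t) := by
  rw [← auxP_coeff, auxP_add, coeff_mul,
    Finset.Nat.sum_antidiagonal_eq_sum_range_succ (fun i j => (auxP m).coeff i * (auxP m').coeff j)]
  simp_rw [auxP_coeff]
  symm
  apply Finset.sum_subset
  · intro t; simp
  · intro t h1 h2
    have : m.card < t := by simp at h1 h2; omega
    simp [Multiset.esymm, Multiset.powersetCard_eq_empty _ this]

theorem aux_esymm_congr {K : Type*} [Field K] [Fintype K] [DecidableEq K] (p l k : ℕ)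
    [Fact p.Prime] [CharP K p] (hk : k < p ^ l) (m m' : Multiset K)
    (h : ∀ α : Kˣ, m.count (α : K) % p ^ l = m'.count (α : K) % p ^ l) :
    m.esymm k = m'.esymm k := by
  let I : Ideal K[X] := Ideal.span {X ^ (k + 1)}
  have hmk : ∀ m : Multiset K, Ideal.Quotient.mk I (auxP m) =
      ∏ a : K, Ideal.Quotient.mk I (1 + C a * X) ^ m.count a := by
    intro m
    rw [auxP, Finset.prod_multiset_map_count, map_prod]
    simp_rw [map_pow]
    apply Finset.prod_subset (Finset.subset_univ _)
    intro x _ hx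
    rw [Multiset.mem_toFinset] at hx
    simp [Multiset.count_eq_zero_of_notMem hx]
  have hu : ∀ a : K, Ideal.Quotient.mk I (1 + C a * X) ^ (p ^ l) = 1 := by
    intro a
    rw [← map_pow, add_pow_char_pow, ← map_one (Ideal.Quotient.mk I), Ideal.Quotient.eq,
      Ideal.mem_span_singleton, one_pow, add_sub_cancel_left, mul_pow]
    exact Dvd.dvd.mul_left (pow_dvd_pow _ hk) _
  have he : Ideal.Quotient.mk I (auxP m) = Ideal.Quotient.mk I (auxP m') := by
    rw [hmk, hmk]
    refine Finset.prod_congr rfl fun a _ => ?_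
    by_cases ha : a = 0
    · simp [ha]
    · rw [pow_eq_pow_mod _ (hu a), pow_eq_pow_mod (m'.count a) (hu a)]
      have := h (Units.mk0 a ha)
      rw [Units.val_mk0] at this
      rw [this]
  rw [Ideal.Quotient.eq, Ideal.mem_span_singleton, X_pow_dvd_iff] at he
  have := he k (Nat.lt_succ_self k)
  rw [coeff_sub, auxP_coeff, auxP_coeff] at this
  exact sub_eq_zero.mp this

/-- Step of the walk. -/
def auxS {K : Type*} [Monoid K] [DecidableEq K] (D : ℕ) (a : K) : Kˣ → ZMod D :=
  fun α => if (α : K) = a then 1 else 0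

theorem auxS_norm {K : Type*} [Field K] [Fintype K] [DecidableEq K] (D : ℕ) [NeZero D]
    (χ : AddChar (Kˣ → ZMod D) ℂ) (hχ : χ ≠ 0) :
    ‖∑ a : K, χ (auxS D a)‖ < Fintype.card K := by
  have h1 : ∃ α : Kˣ, χ (auxS D (α : K)) ≠ 1 := by
    by_contra! hcon
    apply hχ
    ext g
    have hg : g = ∑ α : Kˣ, (g α).val • auxS D (α : K) := by
      ext β
      rw [Finset.sum_apply, Finset.sum_eq_single β]
      · simp only [Pi.smul_apply, auxS, if_true, nsmul_eq_mul, mul_one, ZMod.natCast_zmod_val]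
      · intro x _ hx
        simp [auxS, Units.val_inj, Ne.symm hx]
      · simp
    rw [hg, aux_map_sum]
    simp only [AddChar.map_nsmul_eq_pow, hcon, one_pow, Finset.prod_const_one, AddChar.zero_apply]
  obtain ⟨α, hα⟩ := h1
  have h0 : χ (auxS D (0 : K)) = 1 := by
    have : auxS D (0 : K) = 0 := by ext β; simp [auxS]
    rw [this, AddChar.map_zero_eq_one]
  have hn : ∀ g, ‖χ g‖ = 1 := fun g => AddChar.norm_apply χ g
  have hlt : ‖(1 : ℂ) + χ (auxS D (α : K))‖ < 2 := by
    have : ¬ SameRay ℝ (1 : ℂ) (χ (auxS D (α : K))) := by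
      rw [sameRay_iff_of_norm_eq (by rw [hn, norm_one])]
      exact fun h => hα h.symm
    rw [not_sameRay_iff_norm_add_lt, hn, norm_one] at this
    linarith
  have hne : (α : K) ≠ 0 := α.ne_zero
  have hsplit : ∀ {M : Type} [AddCommMonoid M] (f : K → M),
      ∑ a, f a = f 0 + (f α + ∑ a ∈ (Finset.univ.erase (0 : K)).erase (α : K), f a) := by
    intro M _ f
    rw [Finset.add_sum_erase _ f (by simp [hne]), Finset.add_sum_erase _ f (Finset.mem_univ _)]
  have hc : (Fintype.card K : ℝ) =
      1 + (1 + ∑ a ∈ (Finset.univ.erase (0 : K)).erase (α : K), (1 : ℝ)) := by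
    rw [← hsplit (fun _ => (1 : ℝ))]; simp
  rw [hsplit, hc, h0, ← add_assoc, ← add_assoc]
  refine (norm_add_le _ _).trans_lt ?_
  have := norm_sum_le ((Finset.univ.erase (0 : K)).erase (α : K)) (fun a => χ (auxS D a))
  simp only [hn] at this
  linarith

theorem aux_main {K : Type*} [Field K] [Fintype K] [DecidableEq K] (p l k : ℕ)
    [Fact p.Prime] [CharP K p] (hk : k < p ^ l) (L : K → K) (γ : K) (b : Multiset K) :
    Tendsto
      (fun n : ℕ =>
        ((Finset.univ.filter (fun y : Fin n → K =>
            L ((b + Multiset.map y Finset.univ.val).esymm k) = γ)).card : ℝ) /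
          (Fintype.card K : ℝ) ^ n)
      atTop
      (𝓝 (((Finset.univ.filter
          (fun b : Kˣ → Fin (p ^ l) => L ((Mb b).esymm k) = γ)).card : ℝ) /
        ((p : ℝ) ^ l) ^ (Fintype.card K - 1))) := by
  have hD : NeZero (p ^ l) := ⟨by omega⟩
  let e : ZMod (p ^ l) ≃ Fin (p ^ l) :=
    { toFun := fun x => ⟨x.val, ZMod.val_lt x⟩
      invFun := fun x => ((x : ℕ) : ZMod (p ^ l))
      left_inv := fun x => by simp
      right_inv := fun x => by ext; simp [ZMod.val_natCast, Nat.mod_eq_of_lt x.2] }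
  have hev : ∀ x, ((e x : Fin (p ^ l)) : ℕ) = x.val := fun x => rfl
  have hcount : ∀ (c : Kˣ → Fin (p ^ l)) (α : Kˣ), (Mb c).count (α : K) = c α := by
    intro c α
    rw [Mb, Multiset.count_sum']
    simp [Multiset.count_replicate, Units.val_inj]
  let g0 : Kˣ → ZMod (p ^ l) := fun α => (b.count (α : K) : ZMod (p ^ l))
  let E : (Kˣ → ZMod (p ^ l)) ≃ (Kˣ → Fin (p ^ l)) :=
    (Equiv.addLeft g0).trans (Equiv.piCongrRight fun _ => e)
  have hE : ∀ g α, ((E g α : Fin (p ^ l)) : ℕ) = (g0 α + g α).val := fun g α => rfl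
  have main := aux_equidist (auxS (K := K) (p ^ l)) (fun χ hχ => auxS_norm _ χ hχ)
    (fun g => L ((Mb (E g)).esymm k) = γ)
  have hkey : ∀ (n : ℕ) (y : Fin n → K),
      (Mb (E (∑ i, auxS (p ^ l) (y i)))).esymm k =
        (b + Multiset.map y Finset.univ.val).esymm k := by
    intro n y
    apply aux_esymm_congr p l k hk
    intro α
    rw [hcount, hE, ← Nat.ModEq, ← ZMod.natCast_eq_natCast_iff, ZMod.natCast_zmod_val,
      Multiset.count_add, Multiset.count_map]
    push_cast
    congr 1
    simp [auxS, Finset.sum_apply]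
    rfl
  simp_rw [hkey] at main
  convert main using 3
  · rw [Nat.cast_inj]
    symm
    apply Finset.card_bij (fun g _ => E g)
    · intro g hg; simpa using hg
    · intro g _ g' _ h; exact E.injective h
    · intro c hc
      refine ⟨E.symm c, ?_, by simp⟩
      simpa using hc
  · simp [Fintype.card_units, ZMod.card]

end Helpers

/-- **Lemma 2.4.** For fixed `β ∈ 𝔽_q^j`, the sequence
`(1/q^n) ⬝ #{y ∈ 𝔽_q^n : L(∑_{t=0}^{min(j,k)} e_t(β) e_{k-t}(y)) = γ}` converges to
`D^(-(q-1)) ⬝ #{b : 𝔽_qˣ → {0,…,D-1} : L(esymm_k(M_b)) = γ}`, which is the same limit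
as that of `(1/q^n) ⬝ #{y ∈ 𝔽_q^n : L(e_k(y)) = γ}`. -/
theorem tendsto_prob_shifted_esymm (p r : ℕ) (hp : p.Prime) (hr : 1 ≤ r)
    (K : Type*) [Field K] [Fintype K] [DecidableEq K] (hK : Fintype.card K = p ^ r)
    (L : K →+ K) (k : ℕ) (hk : 1 < k) (j : ℕ) (hj : 1 ≤ j)
    (β : Fin j → K) (γ : K) :
    Tendsto
      (fun n : ℕ =>
        ((Finset.univ.filter (fun y : Fin n → K =>
            L (∑ t ∈ Finset.range (min j k + 1), evalE t β * evalE (k - t) y) = γ)).card : ℝ) /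
          ((p : ℝ) ^ r) ^ n)
      atTop
      (𝓝 (((Finset.univ.filter
          (fun b : Kˣ → Fin (p ^ (Nat.log p k + 1)) => L ((Mb b).esymm k) = γ)).card : ℝ) /
        ((p : ℝ) ^ (Nat.log p k + 1)) ^ (p ^ r - 1))) ∧
    Tendsto
      (fun n : ℕ =>
        ((Finset.univ.filter (fun y : Fin n → K => L (evalE k y) = γ)).card : ℝ) /
          ((p : ℝ) ^ r) ^ n)
      atTop
      (𝓝 (((Finset.univ.filter
          (fun b : Kˣ → Fin (p ^ (Nat.log p k + 1)) => L ((Mb b).esymm k) = γ)).card : ℝ) /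
        ((p : ℝ) ^ (Nat.log p k + 1)) ^ (p ^ r - 1))) := by
  have : Fact p.Prime := ⟨hp⟩
  have : CharP K p := charP_of_card_eq_prime_pow hK
  have hlt : k < p ^ (Nat.log p k + 1) := Nat.lt_pow_succ_log_self hp.one_lt k
  have hc : (Fintype.card K : ℝ) = (p : ℝ) ^ r := by rw [hK]; push_cast; rfl
  constructor
  · have := aux_main p _ k hlt L γ (Multiset.map β Finset.univ.val)
    rw [hc, hK] at this
    simp_rw [aux_esymm_add, Multiset.card_map] at this
    simpa [evalE] using this
  · have := aux_main p _ k hlt L γ (0 : Multiset K)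
    rw [hc, hK] at this
    simpa [evalE] using this
end

section
/- Let p be a prime, q = p^r with r ≥ 1, let L : 𝔽_q → 𝔽_q be an 𝔽_p-linear map, let k > 1 be an integer, D = p^{⌊log_p k⌋+1}, let j ≥ 1 and let F : 𝔽_q^j → 𝔽_q be any function. For δ ∈ 𝔽_q write 𝕡_k(δ) = D^{−(q−1)} · #{ b : 𝔽_q^× → {0,1,…,D−1} : L(esymm_k(M_b)) = δ }. Then for every γ ∈ 𝔽_q, the real sequence (1/q^n) · #{x ∈ 𝔽_q^n : L(e_k(x) + F(x_1,…,x_j)) = γ} (defined for n ≥ j) converges as n → ∞, and its limit equals (1/q^j) · ∑_{δ ∈ 𝔽_q} 𝕡_k(δ) · #{β ∈ 𝔽_q^j : L(F(β)) = γ − δ}. -/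
open Filter Topology

section helpers
open Polynomial

lemma coeff_prod_esymm {K : Type*} [CommRing K] (s : Multiset K) : ∀ k : ℕ,
    ((s.map (fun a => (1 + C a * X : K[X]))).prod).coeff k = s.esymm k := by
  induction s using Multiset.induction with
  | empty =>
    intro k
    cases k with
    | zero => simp [Multiset.esymm]
    | succ k => simp [Multiset.esymm, Polynomial.coeff_one, Multiset.powersetCard_zero_right]
  | cons a s ih =>
    intro k
    cases k with
    | zero => simp [Multiset.esymm, Polynomial.mul_coeff_zero, ih]
    | succ k =>
      rw [Multiset.map_cons, Multiset.prod_cons, add_mul, one_mul, mul_assoc,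
        Polynomial.coeff_add, Polynomial.coeff_C_mul, Polynomial.coeff_X_mul, ih, ih]
      simp [Multiset.esymm, Multiset.powersetCard_cons,
        Multiset.sum_map_mul_left]

/-- The step of the walk attached to a field element. -/
noncomputable def stepG {K : Type*} [Field K] [Fintype K] [DecidableEq K] (D : ℕ) [NeZero D]
    (a : K) : Kˣ → Fin D :=
  if h : a = 0 then 0 else Pi.single (Units.mk0 a h) 1

/-- Multiplicative weight. -/
noncomputable def wt {K Q : Type*} [Field K] [Fintype K] [DecidableEq K] [CommRing Q] {D : ℕ}
    (u : K → Q) (b : Kˣ → Fin D) : Q := ∏ α : Kˣ, u α ^ (b α : ℕ)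

lemma wt_add {K Q : Type*} [Field K] [Fintype K] [DecidableEq K] [CommRing Q] {D : ℕ} [NeZero D]
    (u : K → Q) (hu : ∀ a, u a ^ D = 1) (b c : Kˣ → Fin D) :
    wt u (b + c) = wt u b * wt u c := by
  unfold wt
  rw [← Finset.prod_mul_distrib]
  refine Finset.prod_congr rfl fun α _ => ?_
  rw [Pi.add_apply, Fin.val_add, ← pow_add, ← pow_eq_pow_mod _ (hu _)]

lemma wt_step {K Q : Type*} [Field K] [Fintype K] [DecidableEq K] [CommRing Q] {D : ℕ} [NeZero D]
    (hD : 1 < D) (u : K → Q) (hu0 : u 0 = 1) (a : K) :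
    wt u (stepG D a) = u a := by
  unfold wt stepG
  split_ifs with h
  · simp [h, hu0]
  · rw [Finset.prod_eq_single (Units.mk0 a h)]
    · simp [Nat.mod_eq_of_lt hD]
    · intro b _ hb
      simp [Pi.single_eq_of_ne hb]
    · simp

lemma wt_zero {K Q : Type*} [Field K] [Fintype K] [DecidableEq K] [CommRing Q] {D : ℕ} [NeZero D]
    (u : K → Q) : wt u (0 : Kˣ → Fin D) = 1 := by
  simp [wt]

lemma wt_sum {K Q ι : Type*} [Field K] [Fintype K] [DecidableEq K] [CommRing Q] {D : ℕ} [NeZero D]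
    (hD : 1 < D) (u : K → Q) (hu : ∀ a, u a ^ D = 1) (hu0 : u 0 = 1) (s : Finset ι) (x : ι → K) :
    wt u (∑ i ∈ s, stepG D (x i)) = ∏ i ∈ s, u (x i) := by
  classical
  induction s using Finset.induction with
  | empty => simp [wt_zero]
  | insert i s hi ih =>
    rw [Finset.sum_insert hi, Finset.prod_insert hi, wt_add u hu, ih, wt_step hD u hu0]

lemma evalE_eq {K : Type*} [Field K] [Fintype K] [DecidableEq K] (p : ℕ) [Fact p.Prime]
    [CharP K p] (e k : ℕ) (hD : 1 < p ^ e) [NeZero (p ^ e)] (hk : k < p ^ e) {n : ℕ}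
    (x : Fin n → K) :
    evalE k x = (Mb (∑ i, stepG (p ^ e) (x i))).esymm k := by
  unfold evalE
  rw [← coeff_prod_esymm, ← coeff_prod_esymm, ← sub_eq_zero, ← Polynomial.coeff_sub]
  let I : Ideal K[X] := Ideal.span {(X : K[X]) ^ (p ^ e)}
  let u : K → K[X] ⧸ I := fun a => Ideal.Quotient.mk I (1 + C a * X)
  have hu0 : u 0 = 1 := by simp [u]
  have hu : ∀ a, u a ^ (p ^ e) = 1 := by
    intro a
    have h1 : (1 + C a * X : K[X]) ^ (p ^ e) = 1 + C a ^ (p ^ e) * X ^ (p ^ e) := by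
      rw [add_pow_char_pow, one_pow, mul_pow]
    have h2 : Ideal.Quotient.mk I ((X : K[X]) ^ (p ^ e)) = 0 :=
      Ideal.Quotient.eq_zero_iff_mem.2 (Ideal.mem_span_singleton_self _)
    simp only [u]
    rw [← map_pow, h1, map_add, map_mul, h2, mul_zero, add_zero, map_one]
  have key := wt_sum hD u hu hu0 Finset.univ x
  refine Polynomial.X_pow_dvd_iff.1 ?_ k hk
  rw [← Ideal.mem_span_singleton, ← Ideal.Quotient.eq]
  change Ideal.Quotient.mk I _ = Ideal.Quotient.mk I _
  have e1 : ∀ s : Multiset K, Ideal.Quotient.mk I ((s.map (fun a => (1 + C a * X : K[X]))).prod)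
      = (s.map u).prod := by
    intro s
    rw [map_multiset_prod, Multiset.map_map]
    rfl
  rw [e1, e1, Multiset.map_map]
  refine Eq.trans ?_ (key.symm.trans ?_)
  · rfl
  · unfold wt Mb
    have : ∀ s : Finset Kˣ, ∀ b : Kˣ → Fin (p ^ e),
        ((∑ α ∈ s, Multiset.replicate (b α : ℕ) (α : K)).map u).prod
          = ∏ α ∈ s, u α ^ (b α : ℕ) := by
      intro s b
      induction s using Finset.induction with
      | empty => simp
      | insert i s hi ih => 
        rw [Finset.sum_insert hi, Finset.prod_insert hi, Multiset.map_add, Multiset.prod_add, ih]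
        simp
    exact (this _ _).symm

end helpers

lemma addChar_sum {G ι : Type*} [AddCommGroup G] (ψ : AddChar G ℂ) (s : Finset ι) (f : ι → G) :
    ψ (∑ i ∈ s, f i) = ∏ i ∈ s, ψ (f i) := by
  classical
  induction s using Finset.induction with
  | empty => simp
  | insert i s hi ih =>
    rw [Finset.sum_insert hi, Finset.prod_insert hi, AddChar.map_add_eq_mul, ih]

lemma norm_sum_lt_of_ne {K : Type*} [Fintype K] [DecidableEq K] (v : K → ℂ)
    (hv : ∀ a, ‖v a‖ = 1) (a b : K) (hab : v a ≠ v b) : ‖∑ c, v c‖ < Fintype.card K := by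
  have hne : a ≠ b := fun h => hab (by rw [h])
  rw [← Finset.add_sum_erase _ _ (Finset.mem_univ a), 
    ← Finset.add_sum_erase _ _ (Finset.mem_erase.2 ⟨hne.symm, Finset.mem_univ b⟩), ← add_assoc]
  have h1 : ‖v a + v b‖ < ‖v a‖ + ‖v b‖ := by
    refine norm_add_lt_of_not_sameRay fun h => hab ?_
    exact (sameRay_iff_of_norm_eq (by rw [hv, hv])).1 h
  have h2 := norm_sum_le ((Finset.univ.erase a).erase b) v
  have h3 : ∑ c ∈ (Finset.univ.erase a).erase b, ‖v c‖ + ‖v b‖ + ‖v a‖ = Fintype.card K := by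
    rw [Finset.sum_erase_add _ _ (Finset.mem_erase.2 ⟨hne.symm, Finset.mem_univ b⟩),
      Finset.sum_erase_add _ _ (Finset.mem_univ a)]
    simp [hv]
  have := norm_add_le (v a + v b) (∑ c ∈ (Finset.univ.erase a).erase b, v c)
  linarith

lemma tendsto_walk {K G : Type*} [Fintype K] [Nonempty K] [DecidableEq K] [AddCommGroup G]
    [Fintype G] (f : K → G) (a0 : K) (hf0 : f a0 = 0)
    (hgen : ∀ ψ : AddChar G ℂ, (∀ a, ψ (f a) = 1) → ψ = 0) (h : G → ℂ) :
    Tendsto (fun n : ℕ => (∑ y : Fin n → K, h (∑ i, f (y i))) / (Fintype.card K : ℂ) ^ n) atTop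
      (𝓝 ((∑ g, h g) / Fintype.card G)) := by
  classical
  have hq : (Fintype.card K : ℂ) ≠ 0 := by simp
  have hG : (Fintype.card G : ℂ) ≠ 0 := by simp
  let c : AddChar G ℂ → ℂ := fun ψ => (∑ g, h g * ψ (-g)) / Fintype.card G
  let l : AddChar G ℂ → ℂ := fun ψ => (∑ a, ψ (f a)) / Fintype.card K
  have hh : ∀ g, h g = ∑ ψ, c ψ * ψ g := by
    intro g
    simp only [c, div_mul_eq_mul_div, Finset.sum_mul]
    rw [← Finset.sum_div, Finset.sum_comm, eq_div_iff hG]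
    have : ∀ g', ∑ ψ : AddChar G ℂ, h g' * ψ (-g') * ψ g
        = if g = g' then h g' * Fintype.card G else 0 := by
      intro g'
      have := AddChar.sum_apply_eq_ite (g - g')
      simp only [mul_assoc, ← Finset.mul_sum, ← AddChar.map_add_eq_mul]
      rw [neg_add_eq_sub, this]
      simp [sub_eq_zero]
    simp [this]
  have hmain : ∀ n : ℕ, (∑ y : Fin n → K, h (∑ i, f (y i))) / (Fintype.card K : ℂ) ^ n
      = ∑ ψ, c ψ * l ψ ^ n := by
    intro n
    simp only [hh]
    rw [Finset.sum_comm, Finset.sum_div]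
    refine Finset.sum_congr rfl fun ψ _ => ?_
    rw [← Finset.mul_sum, mul_div_assoc]
    congr 1
    simp only [l, div_pow]
    congr 1
    rw [Fintype.sum_pow]
    refine Finset.sum_congr rfl fun y _ => ?_
    exact addChar_sum ψ _ _
  simp only [hmain]
  have hlim : (∑ g, h g) / Fintype.card G = ∑ ψ : AddChar G ℂ, c ψ * (if ψ = 0 then 1 else 0) := by
    simp [c]
  rw [hlim]
  refine tendsto_finsetSum _ fun ψ _ => Tendsto.const_mul _ ?_
  split_ifs with h0
  · subst h0
    have : l 0 = 1 := by simp [l]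
    rw [this]
    exact tendsto_const_nhds.congr fun n => (one_pow n).symm
  · refine tendsto_pow_atTop_nhds_zero_of_norm_lt_one ?_
    obtain ⟨a, ha⟩ : ∃ a, ψ (f a) ≠ 1 := by
      by_contra! hc
      exact h0 (hgen ψ hc)
    have := norm_sum_lt_of_ne (fun a => ψ (f a)) (fun a => ψ.norm_apply _) a a0
      (by simpa [hf0] using ha)
    simp only [l, norm_div]
    rw [div_lt_one (by simp [Fintype.card_pos])]
    simpa using this

open scoped Fin.CommRing in
lemma step_gen {K : Type*} [Field K] [Fintype K] [DecidableEq K] (D : ℕ) [NeZero D]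
    (ψ : AddChar (Kˣ → Fin D) ℂ) (hψ : ∀ a, ψ (stepG D a) = 1) : ψ = 0 := by
  ext g
  have h1 : ∀ α : Kˣ, ∀ m : ℕ, ψ (Pi.single α (m : Fin D)) = 1 := by
    intro α m
    have h : ψ (Pi.single α 1) = 1 := by
      have := hψ α
      simpa [stepG] using this
    have e : (Pi.single α (m : Fin D) : Kˣ → Fin D) = m • Pi.single α 1 := by
      rw [← Pi.single_smul]; simp
    rw [e, AddChar.map_nsmul_eq_pow, h, one_pow]
  rw [← Finset.univ_sum_single g, addChar_sum]
  refine (Finset.prod_eq_one fun α _ => ?_).trans (by simp)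
  have := h1 α (g α : ℕ)
  simpa using this

lemma tendsto_walk_real {K G : Type*} [Fintype K] [Nonempty K] [DecidableEq K] [AddCommGroup G]
    [Fintype G] (f : K → G) (a0 : K) (hf0 : f a0 = 0)
    (hgen : ∀ ψ : AddChar G ℂ, (∀ a, ψ (f a) = 1) → ψ = 0) (h : G → ℝ) :
    Tendsto (fun n : ℕ => (∑ y : Fin n → K, h (∑ i, f (y i))) / (Fintype.card K : ℝ) ^ n) atTop
      (𝓝 ((∑ g, h g) / Fintype.card G)) := by
  have := tendsto_walk f a0 hf0 hgen (fun g => (h g : ℂ))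
  have h2 := (Complex.continuous_re.tendsto _).comp this
  refine (h2.congr fun n => ?_).trans (le_of_eq ?_)
  · rw [Function.comp_apply, ← Complex.ofReal_re ((∑ y : Fin n → K, h (∑ i, f (y i))) / _)]
    push_cast
    rfl
  · rw [← Complex.ofReal_re ((∑ g, h g) / _)]
    push_cast
    rfl

/-- **Theorem 2.5.** For the perturbation `e_{n,k} + F` (with `F` a function of
the first `j` variables), writing `𝕡_k(δ) = D^(-(q-1)) ⬝ #{b : L(esymm_k(M_b)) = δ}`, the
sequence `(1/q^n) ⬝ #{x ∈ 𝔽_q^n : L(e_k(x) + F(x_1,…,x_j)) = γ}` (for `n = j + m`) converges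
to `(1/q^j) ⬝ ∑_{δ ∈ 𝔽_q} 𝕡_k(δ) ⬝ #{β ∈ 𝔽_q^j : L(F(β)) = γ - δ}`. -/
theorem tendsto_prob_perturbation (p r : ℕ) (hp : p.Prime) (hr : 1 ≤ r)
    (K : Type*) [Field K] [Fintype K] [DecidableEq K] (hK : Fintype.card K = p ^ r)
    (L : K →+ K) (k : ℕ) (hk : 1 < k) (j : ℕ) (hj : 1 ≤ j)
    (F : (Fin j → K) → K) (γ : K) :
    Tendsto
      (fun n : ℕ =>
        ((Finset.univ.filter (fun x : Fin (j + n) → K =>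
            L (evalE k x + F (fun i => x (Fin.castAdd n i))) = γ)).card : ℝ) /
          ((p : ℝ) ^ r) ^ (j + n))
      atTop
      (𝓝 ((1 / ((p : ℝ) ^ r) ^ j) *
        ∑ δ : K,
          (((Finset.univ.filter
              (fun b : Kˣ → Fin (p ^ (Nat.log p k + 1)) => L ((Mb b).esymm k) = δ)).card : ℝ) /
            ((p : ℝ) ^ (Nat.log p k + 1)) ^ (p ^ r - 1)) *
          ((Finset.univ.filter (fun β : Fin j → K => L (F β) = γ - δ)).card : ℝ))) := by
  classical
  have : Fact p.Prime := ⟨hp⟩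
  have : CharP K p := charP_of_card_eq_prime_pow hK
  set e := Nat.log p k + 1 with he
  have hD : 1 < p ^ e := Nat.one_lt_pow (by omega) hp.one_lt
  have hkD : k < p ^ e := Nat.lt_pow_succ_log_self hp.one_lt k
  have : NeZero (p ^ e) := ⟨by omega⟩
  have hqR : (p : ℝ) ^ r = Fintype.card K := by rw [hK]; push_cast; rfl
  have hq0 : (Fintype.card K : ℝ) ≠ 0 := by simp
  let E : (Kˣ → Fin (p ^ e)) → K := fun b => L ((Mb b).esymm k)
  let S : (n : ℕ) → (Fin n → K) → (Kˣ → Fin (p ^ e)) := fun n x => ∑ i, stepG (p ^ e) (x i)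
  let h : (Fin j → K) → (Kˣ → Fin (p ^ e)) → ℝ := fun β g =>
    if E (S j β + g) + L (F β) = γ then 1 else 0
  have hcardG : (Fintype.card (Kˣ → Fin (p ^ e)) : ℝ) = ((p : ℝ) ^ e) ^ (p ^ r - 1) := by
    rw [Fintype.card_fun, Fintype.card_units, hK, Fintype.card_fin]
    push_cast
    rfl
  have hcount : ∀ n : ℕ, ((Finset.univ.filter (fun x : Fin (j + n) → K =>
            L (evalE k x + F (fun i => x (Fin.castAdd n i))) = γ)).card : ℝ) /
          ((p : ℝ) ^ r) ^ (j + n) =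
        (1 / ((p : ℝ) ^ r) ^ j) * ∑ β : Fin j → K,
          (∑ y : Fin n → K, h β (∑ i, stepG (p ^ e) (y i))) / (Fintype.card K : ℝ) ^ n := by
    intro n
    rw [← Finset.sum_div, hqR, Finset.natCast_card_filter, ← (Fin.appendEquiv j n).sum_comp,
      Fintype.sum_prod_type, pow_add, one_div_mul_eq_div, div_div, mul_comm (_ ^ j)]
    congr 1
    refine Finset.sum_congr rfl fun β _ => Finset.sum_congr rfl fun y _ => ?_
    have h1 : (fun i => Fin.appendEquiv j n (β, y) (Fin.castAdd n i)) = β := by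
      funext i
      simp [Fin.appendEquiv]
    have h2 : L (evalE k (Fin.appendEquiv j n (β, y)))
        = E (S j β + ∑ i, stepG (p ^ e) (y i)) := by
      rw [evalE_eq p e k hD hkD, Fin.sum_univ_add]
      simp [Fin.appendEquiv, E, S]
    simp only [h]
    rw [h1, map_add, h2]
  simp only [hcount]
  have hlim : ∑ δ : K,
          (((Finset.univ.filter
              (fun b : Kˣ → Fin (p ^ e) => L ((Mb b).esymm k) = δ)).card : ℝ) /
            ((p : ℝ) ^ e) ^ (p ^ r - 1)) *
          ((Finset.univ.filter (fun β : Fin j → K => L (F β) = γ - δ)).card : ℝ)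
        = ∑ β : Fin j → K, (∑ g, h β g) / Fintype.card (Kˣ → Fin (p ^ e)) := by
    rw [hcardG, ← Finset.sum_div]
    simp only [div_mul_eq_mul_div]
    rw [← Finset.sum_div]
    congr 1
    have h1 : ∀ β, ∑ g, h β g = ∑ g, if E g + L (F β) = γ then (1 : ℝ) else 0 := fun β =>
      Equiv.sum_comp (Equiv.addLeft (S j β)) (fun g => if E g + L (F β) = γ then (1 : ℝ) else 0)
    simp only [h1, Finset.natCast_card_filter, Finset.sum_mul_sum]
    rw [Finset.sum_comm, Finset.sum_comm (s := (Finset.univ : Finset (Fin j → K)))]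
    refine Finset.sum_congr rfl fun g _ => ?_
    rw [Finset.sum_comm]
    refine Finset.sum_congr rfl fun β _ => ?_
    rw [Finset.sum_eq_single (E g)]
    · simp [E, eq_sub_iff_add_eq, add_comm]
    · intro δ _ hδ
      rw [if_neg (fun hh => hδ hh.symm), zero_mul]
    · simp
  rw [hlim]
  refine Tendsto.const_mul _ (tendsto_finsetSum _ fun β _ => ?_)
  exact tendsto_walk_real (stepG (p ^ e)) 0 (by simp [stepG]) (step_gen (p ^ e)) (h β)
end
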